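/- arXiv:2605.24519 — 4 statements merged into one kernel-verified Lean document; each statement's English description precedes it below -/
import Mathlib

section
/- Let G_Z ∈ F_2^{(k+k0)×n} be a triorthogonal matrix whose first k rows form a submatrix G_1 ∈ F_2^{k×n} in which every row has odd Hamming weight, and whose last k0 rows form a submatrix H_X ∈ F_2^{k0×n} in which every row has even Hamming weight. Then the F_2-linear span of the rows of G_1 intersects the F_2-linear span of the rows of H_X trivially: span(rows of G_1) ∩ span(rows of H_X) = {0}. -/
/-- Hamming weight of a vector over `F₂`. -/
def wt {n : ℕ} (y : Fin n → ZMod 2) : ℕ :=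
  (Finset.univ.filter fun j => y j ≠ 0).card

/-- A matrix over `F₂` is triorthogonal if the componentwise products of any
two and of any three distinct rows sum to `0` in `F₂`. -/
def Triorthogonal {r n : ℕ} (A : Matrix (Fin r) (Fin n) (ZMod 2)) : Prop :=
  (∀ b c : Fin r, b < c → ∑ j, A b j * A c j = 0) ∧
  (∀ b c d : Fin r, b < c → c < d → ∑ j, A b j * A c j * A d j = 0)

/-- Over `F₂` the sum of the squared coordinates is the Hamming weight mod `2`. -/
theorem sum_mul_self_eq_wt {n : ℕ} (y : Fin n → ZMod 2) :
    ∑ j, y j * y j = (wt y : ZMod 2) := by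
  have hsq : ∀ a : ZMod 2, a * a = if a ≠ 0 then 1 else 0 := by decide
  simp only [hsq, wt, Finset.sum_boole]

theorem Triorthogonal.dotProduct_eq_zero {r n : ℕ} {A : Matrix (Fin r) (Fin n) (ZMod 2)}
    (hA : Triorthogonal A) {b c : Fin r} (hbc : b ≠ c) : A b ⬝ᵥ A c = 0 := by
  rcases lt_or_gt_of_ne hbc with h | h
  · exact hA.1 b c h
  · rw [dotProduct_comm]
    exact hA.1 c b h

/-- If `G_Z` is triorthogonal, its first `k` rows (the matrix `G₁`) have odd
Hamming weight and its last `k₀` rows (the matrix `H_X`) have even Hamming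
weight, then the span of the rows of `G₁` intersects the span of the rows of
`H_X` trivially. -/
theorem stmt_1 {k k0 n : ℕ} (G : Matrix (Fin (k + k0)) (Fin n) (ZMod 2))
    (htri : Triorthogonal G)
    (hodd : ∀ i : Fin k, Odd (wt (G (Fin.castAdd k0 i))))
    (heven : ∀ i : Fin k0, Even (wt (G (Fin.natAdd k i)))) :
    Submodule.span (ZMod 2) (Set.range fun i : Fin k => G (Fin.castAdd k0 i)) ⊓
      Submodule.span (ZMod 2) (Set.range fun i : Fin k0 => G (Fin.natAdd k i)) = ⊥ := by
  rw [eq_bot_iff]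
  rintro x ⟨hx₁, hx₂⟩
  have hortho : ∀ i : Fin k, G (Fin.castAdd k0 i) ⬝ᵥ x = 0 := by
    intro i
    clear hx₁
    induction hx₂ using Submodule.span_induction with
    | mem y hy =>
      obtain ⟨l, rfl⟩ := hy
      refine htri.dotProduct_eq_zero fun h => ?_
      have := congrArg Fin.val h
      simp only [Fin.val_castAdd, Fin.val_natAdd] at this
      omega
    | zero => exact dotProduct_zero _
    | add y z _ _ hy hz => rw [dotProduct_add, hy, hz, add_zero]
    | smul a y _ hy => rw [dotProduct_smul, hy, smul_zero]
  obtain ⟨a, rfl⟩ := (Submodule.mem_span_range_iff_exists_fun (ZMod 2)).mp hx₁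
  have ha : ∀ i, a i = 0 := by
    intro i
    have h := hortho i
    have hself : G (Fin.castAdd k0 i) ⬝ᵥ G (Fin.castAdd k0 i) = 1 :=
      (sum_mul_self_eq_wt _).trans ((ZMod.natCast_eq_one_iff_odd).mpr (hodd i))
    rw [dotProduct_sum, Finset.sum_eq_single i, dotProduct_smul, hself] at h
    · simpa using h
    · intro l _ hl
      rw [dotProduct_smul, htri.dotProduct_eq_zero, smul_zero]
      exact fun e => hl (Fin.castAdd_injective k k0 e).symm
    · simp
  simp [ha]
end

section
/- Let G_Z ∈ F_2^{(k+k0)×n} be a triorthogonal matrix whose first k rows form a submatrix G_1 ∈ F_2^{k×n} in which every row has odd Hamming weight, and whose last k0 rows form a submatrix H_X ∈ F_2^{k0×n} in which every row has even Hamming weight. Let C_Z ⊆ F_2^n be the F_2-linear span of all rows of G_Z and let C_Z^⊥ be its dual. Then span(rows of H_X) = C_Z ∩ C_Z^⊥. -/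
/-- The dual code of an `F₂`-subspace `C ⊆ F₂ⁿ`, with respect to the standard
inner product `⟨x, y⟩ = ∑ i, x i * y i`. -/
def dualCode {n : ℕ} (C : Submodule (ZMod 2) (Fin n → ZMod 2)) :
    Submodule (ZMod 2) (Fin n → ZMod 2) where
  carrier := {y | ∀ c ∈ C, ∑ i, y i * c i = 0}
  add_mem' := by
    intro a b ha hb c hc
    have h1 := ha c hc
    have h2 := hb c hc
    simp only [Set.mem_setOf_eq, Pi.add_apply, add_mul, Finset.sum_add_distrib, h1, h2,
      add_zero]
  zero_mem' := by
    intro c hc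
    simp
  smul_mem' := by
    intro r a ha c hc
    have h1 := ha c hc
    simp only [Set.mem_setOf_eq, Pi.smul_apply, smul_eq_mul, mul_assoc, ← Finset.mul_sum, h1,
      mul_zero]

theorem Triorthogonal.sum_mul_eq_zero {r n : ℕ} {A : Matrix (Fin r) (Fin n) (ZMod 2)}
    (hA : Triorthogonal A) {b c : Fin r} (hbc : b ≠ c) : ∑ j, A b j * A c j = 0 := by
  rcases lt_or_gt_of_ne hbc with h | h
  · exact hA.1 b c h
  · simpa only [mul_comm] using hA.1 c b h

/-- Membership in the dual of a span can be tested on the spanning family. -/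
theorem mem_dualCode_span_range {ι : Type*} {n : ℕ} (v : ι → Fin n → ZMod 2)
    (y : Fin n → ZMod 2) :
    y ∈ dualCode (Submodule.span (ZMod 2) (Set.range v)) ↔ ∀ i, ∑ j, y j * v i j = 0 := by
  refine ⟨fun h i => h _ (Submodule.subset_span ⟨i, rfl⟩), fun h c hc => ?_⟩
  induction hc using Submodule.span_induction with
  | mem x hx => obtain ⟨i, rfl⟩ := hx; exact h i
  | zero => simp
  | add a b _ _ ha hb => simp [mul_add, Finset.sum_add_distrib, ha, hb]
  | smul t a _ ha => simp [mul_left_comm _ t, ← Finset.mul_sum, ha]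

/-- If `G_Z` is triorthogonal, its first `k` rows (the matrix `G₁`) have odd
Hamming weight and its last `k₀` rows (the matrix `H_X`) have even Hamming
weight, then the span of the rows of `H_X` equals `C_Z ∩ C_Z^⊥`, where `C_Z`
is the span of all rows of `G_Z`. -/
theorem stmt_2 {k k0 n : ℕ} (G : Matrix (Fin (k + k0)) (Fin n) (ZMod 2))
    (htri : Triorthogonal G)
    (hodd : ∀ i : Fin k, Odd (wt (G (Fin.castAdd k0 i))))
    (heven : ∀ i : Fin k0, Even (wt (G (Fin.natAdd k i)))) :
    Submodule.span (ZMod 2) (Set.range fun i : Fin k0 => G (Fin.natAdd k i)) =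
      Submodule.span (ZMod 2) (Set.range fun i : Fin (k + k0) => G i) ⊓
        dualCode (Submodule.span (ZMod 2) (Set.range fun i : Fin (k + k0) => G i)) := by
  apply le_antisymm
  · rw [Submodule.span_le]
    rintro _ ⟨i, rfl⟩
    refine ⟨Submodule.subset_span ⟨_, rfl⟩, (mem_dualCode_span_range _ _).2 fun b => ?_⟩
    by_cases hb : Fin.natAdd k i = b
    · subst hb
      rw [sum_mul_self_eq_wt]
      exact (ZMod.natCast_eq_zero_iff_even).2 (heven i)
    · exact htri.sum_mul_eq_zero hb
  · rintro y ⟨hy, hdual⟩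
    obtain ⟨c, rfl⟩ := (Submodule.mem_span_range_iff_exists_fun (ZMod 2)).1 hy
    have hinner := (mem_dualCode_span_range _ _).1 hdual
    have hc : ∀ i : Fin k, c (Fin.castAdd k0 i) = 0 := by
      intro i
      have h := hinner (Fin.castAdd k0 i)
      simp only [Finset.sum_apply, Pi.smul_apply, smul_eq_mul, Finset.sum_mul, mul_assoc] at h
      rw [Finset.sum_comm] at h
      simp only [← Finset.mul_sum] at h
      rw [Finset.sum_eq_single (Fin.castAdd k0 i)
        (fun b _ hb => by rw [htri.sum_mul_eq_zero hb, mul_zero]) (by simp),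
        sum_mul_self_eq_wt, (ZMod.natCast_eq_one_iff_odd).2 (hodd i), mul_one] at h
      exact h
    rw [Fin.sum_univ_add]
    simp only [hc, zero_smul, Finset.sum_const_zero, zero_add]
    exact Submodule.sum_mem _ fun i _ =>
      Submodule.smul_mem _ _ (Submodule.subset_span ⟨i, rfl⟩)
end

section
/- (MacWilliams theorem for binary codes.) Let C ⊆ F_2^n be an F_2-subspace, and for 0 ≤ j ≤ n let A_j = |{c ∈ C : wt(c) = j}| and B_ℓ = |{y ∈ C^⊥ : wt(y) = ℓ}|. Then for every 0 ≤ ℓ ≤ n, |C| · B_ℓ = Σ_{j=0}^{n} A_j · K_ℓ(j;n). -/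
/-- The binary Krawtchouk polynomial value
`K_ℓ(j; n) = ∑_{s=0}^{ℓ} (-1)^s C(j, s) C(n - j, ℓ - s)`, as an integer. -/
def krawtchouk (ℓ j n : ℕ) : ℤ :=
  ∑ s ∈ Finset.range (ℓ + 1), (-1 : ℤ) ^ s * (j.choose s) * ((n - j).choose (ℓ - s))

open Polynomial in
theorem krawtchouk_eq_coeff (ℓ j n : ℕ) :
    krawtchouk ℓ j n = ((1 - X : ℤ[X]) ^ j * (1 + X) ^ (n - j)).coeff ℓ := by
  have h : ∀ s, ((1 - X : ℤ[X]) ^ j).coeff s = (-1) ^ s * (j.choose s : ℤ) := by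
    intro s
    have : (1 - X : ℤ[X]) ^ j = ((1 + X) ^ j).comp (C (-1) * X) := by
      simp [sub_eq_add_neg]
    rw [this, comp_C_mul_X_coeff, coeff_one_add_X_pow]
    ring
  simp only [coeff_mul, h, coeff_one_add_X_pow,
    Finset.Nat.sum_antidiagonal_eq_sum_range_succ_mk, krawtchouk]

/-- The nontrivial character `a ↦ (-1)^a` of `F₂`, with integer values. -/
def binaryChar : AddChar (ZMod 2) ℤ where
  toFun a := if a = 0 then 1 else -1
  map_zero_eq_one' := by simp
  map_add_eq_mul' := by decide

theorem binaryChar_apply (a : ZMod 2) : binaryChar a = if a = 0 then 1 else -1 := rfl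

theorem binaryChar_sum {ι : Type*} (s : Finset ι) (f : ι → ZMod 2) :
    binaryChar (∑ i ∈ s, f i) = ∏ i ∈ s, binaryChar (f i) := by
  classical
  induction s using Finset.induction_on with
  | empty => simp
  | insert a s ha ih => simp [ha, AddChar.map_add_eq_mul, ih]

open Polynomial in
theorem sum_binaryChar_mul_X_pow_wt {n : ℕ} (c : Fin n → ZMod 2) :
    ∑ y : Fin n → ZMod 2, C (binaryChar (∑ i, y i * c i)) * X ^ wt y =
      (1 - X : ℤ[X]) ^ wt c * (1 + X) ^ (n - wt c) := by
  have hterm : ∀ y : Fin n → ZMod 2, C (binaryChar (∑ i, y i * c i)) * (X : ℤ[X]) ^ wt y =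
      ∏ i, C (binaryChar (y i * c i)) * (if y i ≠ 0 then X else 1) := by
    intro y
    rw [binaryChar_sum, map_prod, Finset.prod_mul_distrib]
    congr 1
    rw [Finset.prod_ite]
    simp [wt]
  have hfactor : ∀ i, ∑ a : ZMod 2, C (binaryChar (a * c i)) * (if a ≠ 0 then X else 1) =
      if c i ≠ 0 then (1 - X : ℤ[X]) else 1 + X := by
    intro i
    have h2 : (Finset.univ : Finset (ZMod 2)) = {0, 1} := rfl
    rw [h2, Finset.sum_pair (by decide)]
    by_cases h : c i = 0 <;> simp [binaryChar_apply, h, sub_eq_add_neg]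
  have hcard : (Finset.univ.filter fun i => ¬ c i ≠ 0).card = n - wt c := by
    have := Finset.card_filter_add_card_filter_not (s := Finset.univ) (fun i => c i ≠ 0)
    rw [Finset.card_univ, Fintype.card_fin] at this
    unfold wt
    omega
  simp only [hterm]
  rw [← Fintype.prod_sum fun i (a : ZMod 2) =>
    C (binaryChar (a * c i)) * (if a ≠ 0 then (X : ℤ[X]) else 1)]
  simp only [hfactor]
  rw [Finset.prod_ite, Finset.prod_const, Finset.prod_const, hcard]
  rfl

theorem sum_binaryChar_of_wt_eq {n : ℕ} (c : Fin n → ZMod 2) (ℓ : ℕ) :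
    ∑ y : Fin n → ZMod 2 with wt y = ℓ, binaryChar (∑ i, y i * c i) =
      krawtchouk ℓ (wt c) n := by
  rw [krawtchouk_eq_coeff, ← sum_binaryChar_mul_X_pow_wt, Polynomial.finsetSum_coeff,
    Finset.sum_filter]
  simp only [Polynomial.coeff_C_mul_X_pow, eq_comm]

open Classical in
theorem sum_binaryChar_code {n : ℕ} (C : Submodule (ZMod 2) (Fin n → ZMod 2))
    (y : Fin n → ZMod 2) :
    ∑ c : C, binaryChar (∑ i, y i * (c : Fin n → ZMod 2) i) =
      if y ∈ dualCode C then (Nat.card C : ℤ) else 0 := by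
  let φ : C →+ ZMod 2 :=
    { toFun := fun c => ∑ i, y i * (c : Fin n → ZMod 2) i
      map_zero' := by simp
      map_add' := by intro a b; simp [mul_add, Finset.sum_add_distrib] }
  have hφ : binaryChar.compAddMonoidHom φ = 0 ↔ y ∈ dualCode C := by
    rw [AddChar.eq_zero_iff]
    refine ⟨fun h c hc => ?_, fun h c => ?_⟩
    · by_contra hne
      have := h ⟨c, hc⟩
      simp [φ, binaryChar_apply, hne] at this
    · have := h c c.2
      simp [φ, this]
  have := AddChar.sum_eq_ite (binaryChar.compAddMonoidHom φ)
  simp only [hφ, ← Nat.card_eq_fintype_card] at this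
  exact this

theorem wt_le {n : ℕ} (y : Fin n → ZMod 2) : wt y ≤ n := by
  simpa [wt] using Finset.card_filter_le Finset.univ fun j => y j ≠ 0

/-- MacWilliams theorem for binary codes: if `A_j` counts the weight-`j`
codewords of `C` and `B_ℓ` the weight-`ℓ` codewords of `C^⊥`, then
`|C| ⬝ B_ℓ = ∑_{j=0}^n A_j K_ℓ(j; n)` for every `0 ≤ ℓ ≤ n`. -/
theorem stmt_5 {n : ℕ} (C : Submodule (ZMod 2) (Fin n → ZMod 2)) (ℓ : ℕ) (hℓ : ℓ ≤ n) :
    (Nat.card C : ℤ) *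
        (Nat.card {y : Fin n → ZMod 2 // y ∈ dualCode C ∧ wt y = ℓ} : ℤ) =
      ∑ j ∈ Finset.range (n + 1),
        (Nat.card {c : Fin n → ZMod 2 // c ∈ C ∧ wt c = j} : ℤ) * krawtchouk ℓ j n := by
  classical
  have hB : (Nat.card C : ℤ) *
        (Nat.card {y : Fin n → ZMod 2 // y ∈ dualCode C ∧ wt y = ℓ} : ℤ) =
      ∑ y : Fin n → ZMod 2 with wt y = ℓ,
        ∑ c : C, binaryChar (∑ i, y i * (c : Fin n → ZMod 2) i) := by
    simp only [sum_binaryChar_code]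
    rw [← Finset.sum_filter, Finset.filter_filter, Finset.sum_const, nsmul_eq_mul, mul_comm,
      Nat.card_eq_fintype_card, Fintype.card_subtype]
    simp only [and_comm]
  have hA : ∀ j, (Nat.card {c : Fin n → ZMod 2 // c ∈ C ∧ wt c = j} : ℤ) =
      ((Finset.univ.filter fun c : C => wt (c : Fin n → ZMod 2) = j).card : ℤ) := by
    intro j
    rw [← Fintype.card_subtype, ← Nat.card_eq_fintype_card]
    exact congrArg _ (Nat.card_congr
      (Equiv.subtypeSubtypeEquivSubtypeInter (· ∈ C) fun c => wt c = j).symm)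
  rw [hB, Finset.sum_comm]
  simp only [sum_binaryChar_of_wt_eq, hA]
  rw [← Finset.sum_fiberwise_of_maps_to (s := Finset.univ) (t := Finset.range (n + 1))
    (g := fun c : C => wt (c : Fin n → ZMod 2))
    fun c _ => Finset.mem_range.2 (Nat.lt_succ_of_le (wt_le _))]
  refine Finset.sum_congr rfl fun j _ => ?_
  rw [← nsmul_eq_mul, ← Finset.sum_const]
  exact Finset.sum_congr rfl fun c hc => by rw [(Finset.mem_filter.1 hc).2]
end

section
/- For every matrix H ∈ F_2^{k×n} and every 1 ≤ ℓ ≤ n, the identity Σ_{u ∈ F_2^k, u ≠ 0} K_ℓ(wt(uᵀH); n) = −C(n,ℓ) holds if and only if there is no nonzero y ∈ F_2^n with H y = 0 and wt(y) = ℓ. -/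
/-- The nontrivial additive character of `F₂`, with values in `ℤ`. -/
def signChar : AddChar (ZMod 2) ℤ where
  toFun a := if a = 0 then 1 else -1
  map_zero_eq_one' := rfl
  map_add_eq_mul' := by decide

lemma signChar_sum {ι : Type*} (s : Finset ι) (f : ι → ZMod 2) :
    signChar (∑ i ∈ s, f i) = ∏ i ∈ s, signChar (f i) :=
  map_prod signChar.toMonoidHom (fun i => Multiplicative.ofAdd (f i)) s

lemma sum_signChar_dotProduct {k : ℕ} (v : Fin k → ZMod 2) :
    ∑ u : Fin k → ZMod 2, signChar (u ⬝ᵥ v) = if v = 0 then 2 ^ k else 0 := by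
  have hsum : ∀ b : ZMod 2, ∑ a, signChar (a * b) = if b = 0 then 2 else 0 := by decide
  have hprod : ∑ u : Fin k → ZMod 2, signChar (u ⬝ᵥ v) = ∏ i, ∑ a, signChar (a * v i) := by
    simp only [dotProduct, signChar_sum, Finset.prod_univ_sum, Fintype.piFinset_univ]
  rw [hprod]
  simp only [hsum]
  split_ifs with hv
  · simp [hv]
  · obtain ⟨i, hi⟩ := Function.ne_iff.mp hv
    exact Finset.prod_eq_zero (Finset.mem_univ i) (if_neg hi)

open Polynomial in
lemma coeff_one_sub_X_pow_mul_one_add_X_pow (ℓ j n : ℕ) :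
    ((1 - X : ℤ[X]) ^ j * (1 + X) ^ (n - j)).coeff ℓ = krawtchouk ℓ j n := by
  have hsub : ∀ s, ((1 - X : ℤ[X]) ^ j).coeff s = (-1) ^ s * j.choose s := by
    intro s
    have hcomp : (1 - X : ℤ[X]) ^ j = ((1 + X) ^ j).comp (C (-1) * X) := by
      simp [sub_eq_add_neg]
    rw [hcomp, comp_C_mul_X_coeff, coeff_one_add_X_pow, mul_comm]
  rw [coeff_mul, Finset.Nat.sum_antidiagonal_eq_sum_range_succ_mk, krawtchouk]
  simp only [hsub, coeff_one_add_X_pow]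

open Polynomial in
lemma sum_signChar_mul_X_pow_wt {n : ℕ} (x : Fin n → ZMod 2) :
    ∑ y : Fin n → ZMod 2, C (signChar (x ⬝ᵥ y)) * (X : ℤ[X]) ^ wt y =
      (1 - X) ^ wt x * (1 + X) ^ (n - wt x) := by
  have hterm : ∀ y : Fin n → ZMod 2, C (signChar (x ⬝ᵥ y)) * (X : ℤ[X]) ^ wt y =
      ∏ j, C (signChar (x j * y j)) * X ^ (if y j ≠ 0 then 1 else 0) := by
    intro y
    rw [Finset.prod_mul_distrib, Finset.prod_pow_eq_pow_sum, ← map_prod, dotProduct,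
      signChar_sum, wt, Finset.card_filter]
  have hfactor : ∀ b : ZMod 2,
      ∑ a : ZMod 2, C (signChar (b * a)) * (X : ℤ[X]) ^ (if a ≠ 0 then 1 else 0) =
        if b ≠ 0 then 1 - X else 1 + X := by
    have huniv : (Finset.univ : Finset (ZMod 2)) = {0, 1} := rfl
    have hone : signChar 1 = -1 := rfl
    have hcases : ∀ b : ZMod 2, b = 0 ∨ b = 1 := by decide
    intro b
    rw [huniv, Finset.sum_pair zero_ne_one]
    rcases hcases b with rfl | rfl <;> simp [hone, sub_eq_add_neg]
  have hcompl : (Finset.univ.filter fun j => ¬ x j ≠ 0).card = n - wt x := by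
    have h := Finset.card_filter_add_card_filter_not (s := Finset.univ) (fun j => x j ≠ 0)
    rw [Finset.card_univ, Fintype.card_fin] at h
    exact Nat.eq_sub_of_add_eq' h
  have hprod : ∑ y : Fin n → ZMod 2, C (signChar (x ⬝ᵥ y)) * (X : ℤ[X]) ^ wt y =
      ∏ j, ∑ a : ZMod 2, C (signChar (x j * a)) * X ^ (if a ≠ 0 then 1 else 0) := by
    simp only [hterm, Finset.prod_univ_sum, Fintype.piFinset_univ]
  rw [hprod, Finset.prod_congr rfl fun j _ => hfactor (x j), Finset.prod_ite,
    Finset.prod_const, Finset.prod_const, hcompl, wt]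

/-- The Krawtchouk value at `wt x` is the character sum at `x` over the sphere of radius `ℓ`. -/
lemma krawtchouk_wt_eq_sum {n : ℕ} (ℓ : ℕ) (x : Fin n → ZMod 2) :
    krawtchouk ℓ (wt x) n =
      ∑ y ∈ Finset.univ.filter (fun y : Fin n → ZMod 2 => wt y = ℓ), signChar (x ⬝ᵥ y) := by
  rw [← coeff_one_sub_X_pow_mul_one_add_X_pow, ← sum_signChar_mul_X_pow_wt,
    Polynomial.finsetSum_coeff, Finset.sum_filter]
  simp only [Polynomial.coeff_C_mul_X_pow, eq_comm]

lemma krawtchouk_zero_right (ℓ n : ℕ) : krawtchouk ℓ 0 n = n.choose ℓ := by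
  rw [← coeff_one_sub_X_pow_mul_one_add_X_pow]
  simp [Polynomial.coeff_one_add_X_pow]

lemma wt_zero {n : ℕ} : wt (0 : Fin n → ZMod 2) = 0 := by
  simp [wt]

/-- The Krawtchouk values summed over the row space count the kernel vectors of weight `ℓ`. -/
lemma sum_krawtchouk_wt_vecMul {k n : ℕ} (H : Matrix (Fin k) (Fin n) (ZMod 2)) (ℓ : ℕ) :
    ∑ u : Fin k → ZMod 2, krawtchouk ℓ (wt (Matrix.vecMul u H)) n =
      2 ^ k * (Finset.univ.filter
        fun y : Fin n → ZMod 2 => wt y = ℓ ∧ H.mulVec y = 0).card := by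
  simp only [krawtchouk_wt_eq_sum]
  rw [Finset.sum_comm]
  simp only [← Matrix.dotProduct_mulVec, sum_signChar_dotProduct]
  rw [← Finset.sum_filter, Finset.filter_filter, Finset.sum_const, nsmul_eq_mul, mul_comm]

/-- For every `H ∈ F₂^{k×n}` and `1 ≤ ℓ ≤ n`, the equality
`∑_{u ≠ 0} K_ℓ(wt(uᵀH); n) = -C(n, ℓ)` holds if and only if there is no
nonzero `y ∈ F₂ⁿ` with `H y = 0` and `wt y = ℓ`. -/
theorem stmt_9 {k n : ℕ} (H : Matrix (Fin k) (Fin n) (ZMod 2)) (ℓ : ℕ)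
    (hℓ1 : 1 ≤ ℓ) (hℓn : ℓ ≤ n) :
    (∑ u ∈ Finset.univ.filter (fun u : Fin k → ZMod 2 => u ≠ 0),
        krawtchouk ℓ (wt (Matrix.vecMul u H)) n = -(n.choose ℓ : ℤ)) ↔
      ¬∃ y : Fin n → ZMod 2, y ≠ 0 ∧ H.mulVec y = 0 ∧ wt y = ℓ := by
  have hsplit := Finset.sum_filter_add_sum_filter_not Finset.univ
    (fun u : Fin k → ZMod 2 => u ≠ 0) (fun u => krawtchouk ℓ (wt (Matrix.vecMul u H)) n)
  simp only [not_not] at hsplit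
  rw [Finset.filter_eq' Finset.univ (0 : Fin k → ZMod 2), if_pos (Finset.mem_univ _),
    Finset.sum_singleton, Matrix.zero_vecMul, wt_zero, krawtchouk_zero_right,
    sum_krawtchouk_wt_vecMul] at hsplit
  rw [eq_neg_iff_add_eq_zero, hsplit, mul_eq_zero, or_iff_right (by positivity),
    Nat.cast_eq_zero, Finset.card_eq_zero, Finset.filter_eq_empty_iff, not_exists]
  refine ⟨fun h y ⟨_, hH, hw⟩ => h (Finset.mem_univ y) ⟨hw, hH⟩,
    fun h y _ ⟨hw, hH⟩ => h y ⟨?_, hH, hw⟩⟩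
  rintro rfl
  rw [wt_zero] at hw
  omega
end
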